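/- Let k ≥ 3 and N ≥ 2 be integers, and let (V, E) be an almost-acyclic k-uniform hypergraph with r = |E| hyperedges whose number of nontrivial connected components is t. Then every B ∈ 𝓑(E) satisfies ‖ΣB‖_H ≥ 2t and ‖ΣB‖_H ≥ (4/5)·r. -/

import Mathlib

open Finset

variable {V : Type*} [Fintype V] [DecidableEq V]

/-- The simple graph associated to a `k`-uniform hypergraph: distinct vertices are
adjacent iff some hyperedge contains both. -/
def hGraph {k : ℕ} (E : Finset (Fin k → V)) : SimpleGraph V :=
  SimpleGraph.fromRel (fun u v => ∃ e ∈ E, ∃ i j : Fin k, e i = u ∧ e j = v)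

/-- A connected component is nontrivial if it contains at least two vertices. -/
def NontrivComp {k : ℕ} (E : Finset (Fin k → V)) (c : (hGraph E).ConnectedComponent) : Prop :=
  ∃ u v : V, u ≠ v ∧ (hGraph E).connectedComponentMk u = c ∧
    (hGraph E).connectedComponentMk v = c

/-- The number of nontrivial connected components of a hypergraph. -/
noncomputable def ntCount {k : ℕ} (E : Finset (Fin k → V)) : ℕ :=
  Nat.card {c : (hGraph E).ConnectedComponent // NontrivComp E c}

/-- The vertices of a hyperedge. -/
def edgeVerts {k : ℕ} (e : Fin k → V) : Finset V := Finset.image e Finset.univ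

/-- The set of vertices covered by a set of hyperedges. -/
def cover {k : ℕ} (E' : Finset (Fin k → V)) : Finset V := E'.biUnion edgeVerts

/-- If each `f i` is supported in `A i`, then a coordinate at which exactly one `f i` is nonzero
survives in the sum, and all others are controlled by the overlaps of the sets `A i`. -/
lemma sum_card_support_add_two_mul_card_biUnion_le {ι M : Type*} [AddCommMonoid M]
    [DecidableEq M] (s : Finset ι) (A : ι → Finset V) (f : ι → V → M)
    (hf : ∀ i v, f i v ≠ 0 → v ∈ A i) :
    ∑ i ∈ s, (univ.filter (fun v => f i v ≠ 0)).card + 2 * (s.biUnion A).card ≤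
      (univ.filter (fun v => ∑ i ∈ s, f i v ≠ 0)).card + 2 * ∑ i ∈ s, (A i).card := by
  classical
  have h1 : ∑ i ∈ s, (univ.filter (fun v => f i v ≠ 0)).card =
      ∑ v : V, (s.filter (fun i => f i v ≠ 0)).card := by
    simp only [card_filter]
    exact sum_comm
  have h2 : ∑ i ∈ s, (A i).card = ∑ v : V, (s.filter (fun i => v ∈ A i)).card := by
    simp only [card_filter]
    rw [sum_comm]
    refine sum_congr rfl fun i _ => ?_
    rw [← card_filter]
    simp
  have h3 : (s.biUnion A).card = ∑ v : V, if v ∈ s.biUnion A then 1 else 0 := by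
    rw [← card_filter, filter_univ_mem]
  rw [h1, h2, h3, card_filter, mul_sum, mul_sum, ← sum_add_distrib, ← sum_add_distrib]
  refine sum_le_sum fun v _ => ?_
  have hle : (s.filter (fun i => f i v ≠ 0)).card ≤ (s.filter (fun i => v ∈ A i)).card :=
    card_le_card (monotone_filter_right s fun i _ => hf i v)
  have hpos : v ∈ s.biUnion A → 1 ≤ (s.filter (fun i => v ∈ A i)).card := by
    intro hv
    obtain ⟨i, hi, hv⟩ := mem_biUnion.mp hv
    exact card_pos.mpr ⟨i, mem_filter.mpr ⟨hi, hv⟩⟩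
  have hone : (s.filter (fun i => f i v ≠ 0)).card = 1 → ∑ i ∈ s, f i v ≠ 0 := by
    intro h
    obtain ⟨i, hi⟩ := card_eq_one.mp h
    rw [← sum_filter_ne_zero, hi, sum_singleton]
    have : i ∈ s.filter (fun i => f i v ≠ 0) := hi ▸ mem_singleton_self i
    exact (mem_filter.mp this).2
  split_ifs with hv hs <;> grind

lemma card_edgeVerts {W : Type*} [DecidableEq W] {k : ℕ} {e : Fin k → W}
    (he : Function.Injective e) :
    (edgeVerts e).card = k := by
  simp [edgeVerts, card_image_of_injective _ he]

lemma hGraph_mk_eq {W : Type*} {k : ℕ} {E : Finset (Fin k → W)} {e : Fin k → W}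
    (he : e ∈ E) (i j : Fin k) :
    (hGraph E).connectedComponentMk (e i) = (hGraph E).connectedComponentMk (e j) := by
  by_cases h : e i = e j
  · rw [h]
  · refine SimpleGraph.ConnectedComponent.sound (SimpleGraph.Adj.reachable ?_)
    exact (SimpleGraph.fromRel_adj _ _ _).mpr ⟨h, Or.inl ⟨e, he, i, j, rfl, rfl⟩⟩

lemma NontrivComp.exists_edge {W : Type*} {k : ℕ} {E : Finset (Fin k → W)}
    {c : (hGraph E).ConnectedComponent} (hc : NontrivComp E c) :
    ∃ e ∈ E, ∃ i, (hGraph E).connectedComponentMk (e i) = c := by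
  obtain ⟨u, v, huv, hu, hv⟩ := hc
  obtain ⟨p⟩ := SimpleGraph.ConnectedComponent.exact (hu.trans hv.symm)
  cases p with
  | nil => exact absurd rfl huv
  | cons h _ =>
    obtain ⟨-, ⟨e, he, i, j, hi, -⟩ | ⟨e, he, i, j, -, hi⟩⟩ := (SimpleGraph.fromRel_adj _ _ _).mp h
    · exact ⟨e, he, i, by rw [hi, hu]⟩
    · exact ⟨e, he, j, by rw [hi, hu]⟩

/-- Every `B ∈ 𝓑(E)` of an almost-acyclic hypergraph with `t` nontrivial connected
components and `r` hyperedges satisfies `‖ΣB‖_H ≥ 2t` and `‖ΣB‖_H ≥ (4/5)·r`. -/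
theorem stmt13 (k N : ℕ) [NeZero N] (hk : 3 ≤ k) (hN : 2 ≤ N)
    (E : Finset (Fin k → V)) (r : ℕ) (hEr : E.card = r)
    (hinj : ∀ e ∈ E, Function.Injective e)
    (hac : ∀ E' ⊆ E, (E'.card : ℝ) * ((k : ℝ) - 1.1) ≤ ((cover E').card : ℝ))
    (t : ℕ) (ht : ntCount E = t)
    (B : {e // e ∈ E} → V → ZMod N)
    (hBsupp : ∀ e : {e // e ∈ E}, ∀ v, B e v ≠ 0 → ∃ i, (e : Fin k → V) i = v)
    (hBw : ∀ e : {e // e ∈ E}, 3 ≤ (Finset.univ.filter (fun v => B e v ≠ 0)).card) :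
    2 * t ≤ (Finset.univ.filter (fun v => (∑ e, B e) v ≠ 0)).card ∧
    (4 : ℝ) / 5 * (r : ℝ) ≤ ((Finset.univ.filter (fun v => (∑ e, B e) v ≠ 0)).card : ℝ) := by
  classical
  have key : ∀ s : Finset {e // e ∈ E}, 4 * s.card ≤
      5 * (univ.filter (fun v => ∑ e ∈ s, B e v ≠ 0)).card ∧
      (s.card = 1 → 3 ≤ (univ.filter (fun v => ∑ e ∈ s, B e v ≠ 0)).card) := by
    intro s
    have h := sum_card_support_add_two_mul_card_biUnion_le s
      (fun e => edgeVerts (e : Fin k → V)) B (fun e v hv => by simpa [edgeVerts] using hBsupp e v hv)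
    have hk' : ∑ e ∈ s, (edgeVerts (e : Fin k → V)).card = s.card * k :=
      sum_const_nat fun e _ => card_edgeVerts (hinj e e.2)
    have h3 : s.card * 3 ≤ ∑ e ∈ s, (univ.filter (fun v => B e v ≠ 0)).card := by
      simpa using card_nsmul_le_sum s _ 3 fun e _ => hBw e
    rw [hk'] at h
    constructor
    · have hcov := hac (s.map (Function.Embedding.subtype _)) fun e he => by
        obtain ⟨a, -, rfl⟩ := mem_map.mp he
        exact a.2
      have heq : cover (s.map (Function.Embedding.subtype _)) =
          s.biUnion (fun e => edgeVerts (e : Fin k → V)) := by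
        simp [cover, map_eq_image, image_biUnion]
      rw [heq, card_map] at hcov
      have hR : (s.card : ℝ) * 3 +
          2 * ((s.biUnion (fun e => edgeVerts (e : Fin k → V))).card : ℝ) ≤
          ((univ.filter (fun v => ∑ e ∈ s, B e v ≠ 0)).card : ℝ) + 2 * (s.card * k) := by
        exact_mod_cast (Nat.add_le_add_right h3 _).trans h
      have : (4 : ℝ) * s.card ≤ 5 * ((univ.filter (fun v => ∑ e ∈ s, B e v ≠ 0)).card : ℝ) := by
        linarith
      exact_mod_cast this
    · intro h1
      obtain ⟨e, rfl⟩ := card_eq_one.mp h1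
      simpa using hBw e
  simp only [Finset.sum_apply]
  constructor
  · let z : Fin k := ⟨0, by omega⟩
    have hcomp : ∀ c : (hGraph E).ConnectedComponent, NontrivComp E c →
        2 ≤ ((univ.filter (fun v => ∑ e, B e v ≠ 0)).filter
          (fun v => (hGraph E).connectedComponentMk v = c)).card := by
      intro c hc
      let s : Finset {e // e ∈ E} :=
        univ.filter (fun e => (hGraph E).connectedComponentMk ((e : Fin k → V) z) = c)
      have hs : 1 ≤ s.card := by
        obtain ⟨e, he, i, hi⟩ := hc.exists_edge
        exact card_pos.mpr ⟨⟨e, he⟩, by simpa [s, hGraph_mk_eq he z i] using hi⟩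
      have h2 : 2 ≤ (univ.filter (fun v => ∑ e ∈ s, B e v ≠ 0)).card := by
        have := key s
        omega
      refine h2.trans (card_le_card fun v hv => ?_)
      have hmk : ∀ e, B e v ≠ 0 → (hGraph E).connectedComponentMk ((e : Fin k → V) z) =
          (hGraph E).connectedComponentMk v := by
        intro e he
        obtain ⟨i, rfl⟩ := hBsupp e v he
        exact hGraph_mk_eq e.2 z i
      have hv' : ∑ e ∈ s, B e v ≠ 0 := (mem_filter.mp hv).2
      obtain ⟨e, hes, he⟩ := exists_ne_zero_of_sum_ne_zero hv'
      have hvc : (hGraph E).connectedComponentMk v = c :=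
        (hmk e he).symm.trans (mem_filter.mp hes).2
      have hsum : ∑ e ∈ s, B e v = ∑ e, B e v := by
        refine sum_subset (subset_univ s) fun a _ ha => ?_
        by_contra hne
        exact ha (mem_filter.mpr ⟨mem_univ a, (hmk a hne).trans hvc⟩)
      simp only [mem_filter, mem_univ, true_and]
      exact ⟨hsum ▸ hv', hvc⟩
    have : Fintype (hGraph E).ConnectedComponent := Fintype.ofFinite _
    have htc : t = (univ.filter (fun c => NontrivComp E c)).card := by
      rw [← ht, ntCount, Nat.card_eq_fintype_card, Fintype.card_subtype]
    rw [htc, mul_comm, ← smul_eq_mul]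
    refine (card_nsmul_le_sum _ _ 2 fun c hc => hcomp c (mem_filter.mp hc).2).trans ?_
    rw [card_eq_sum_card_fiberwise (f := (hGraph E).connectedComponentMk) (t := univ)
      (fun _ _ => by simp)]
    exact sum_le_sum_of_subset (subset_univ _)
  · have h := (key univ).1
    rw [card_univ, Fintype.card_coe, hEr] at h
    have hR : (4 : ℝ) * r ≤ 5 * ((univ.filter (fun v => ∑ e, B e v ≠ 0)).card : ℝ) := by
      exact_mod_cast h
    linarith
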